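/- If two pointed systems are bisimilar, then they are L^◇_∞-elementarily equivalent: if (𝓜, M, ā) ↔ (𝓝, N, b̄), then for every L^◇_∞-formula φ we have 𝓜, M ⊨ φ[ā] if and only if 𝓝, N ⊨ φ[b̄]. (Fundamental Theorem of Bisimulations.) -/

import Mathlib

open FirstOrder Language

namespace Potentialist

/-- The underlying data of a potentialist system: a collection of worlds, each carrying a
first-order `L`-structure. -/
structure PreSys.{u, v, w, x} (L : FirstOrder.Language.{u, v}) where
  World : Type w
  Dom : World → Type x
  str : ∀ W, L.Structure (Dom W)

attribute [instance] PreSys.str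

/-- A potentialist system: a collection of first-order `L`-structures together with a
collection of `L`-embeddings between them, containing all identity embeddings and closed
under composition. -/
structure PotSys.{u, v, w, x} (L : FirstOrder.Language.{u, v})
    extends PreSys.{u, v, w, x} L where
  Emb : ∀ W W' : World, Set (Dom W ↪[L] Dom W')
  id_mem : ∀ W : World, Embedding.refl L (Dom W) ∈ Emb W W
  comp_mem : ∀ {W W' W'' : World} (f : Dom W ↪[L] Dom W') (g : Dom W' ↪[L] Dom W''),
    f ∈ Emb W W' → g ∈ Emb W' W'' → g.comp f ∈ Emb W W''

/-- Two tuples (in possibly different structures) satisfy the same atomic `L`-formulas. -/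
def AtomicEquiv.{u, v, y, z} (L : FirstOrder.Language.{u, v}) {M : Type y} {N : Type z}
    [L.Structure M] [L.Structure N] {n : ℕ} (a : Fin n → M) (b : Fin n → N) : Prop :=
  ∀ φ : L.Formula (Fin n), BoundedFormula.IsAtomic φ → (φ.Realize a ↔ φ.Realize b)

/-- The type of relations between pairs `(M, ā)` and `(N, b̄)` of equal parameter size. -/
abbrev BisimRel.{u, v, w, x, w', x'} {L : FirstOrder.Language.{u, v}}
    (S : PotSys.{u, v, w, x} L) (T : PotSys.{u, v, w', x'} L) :=
  ∀ (n : ℕ) (M : S.World), (Fin n → S.Dom M) → ∀ N : T.World, (Fin n → T.Dom N) → Prop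

/-- `R` is a bisimulation between the potentialist systems `S` and `T`: it is nonempty, and
whenever `R` relates `(M, ā)` to `(N, b̄)`: (B1) `ā` and `b̄` satisfy the same atomic formulas;
(B2) any extension of either tuple by one element can be matched on the other side;
(B3) any embedding on either side can be matched by an embedding on the other side. -/
def IsBisimulation.{u, v, w, x, w', x'} {L : FirstOrder.Language.{u, v}}
    (S : PotSys.{u, v, w, x} L) (T : PotSys.{u, v, w', x'} L) (R : BisimRel S T) : Prop :=
  (∃ n M a N b, R n M a N b) ∧
  ∀ (n : ℕ) (M : S.World) (a : Fin n → S.Dom M) (N : T.World) (b : Fin n → T.Dom N),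
    R n M a N b →
      AtomicEquiv L a b ∧
      (∀ c : S.Dom M, ∃ d : T.Dom N, R (n + 1) M (Fin.snoc a c) N (Fin.snoc b d)) ∧
      (∀ d : T.Dom N, ∃ c : S.Dom M, R (n + 1) M (Fin.snoc a c) N (Fin.snoc b d)) ∧
      (∀ (M' : S.World) (π : S.Dom M ↪[L] S.Dom M'), π ∈ S.Emb M M' →
        ∃ (N' : T.World) (ρ : T.Dom N ↪[L] T.Dom N'), ρ ∈ T.Emb N N' ∧
          R n M' (fun i => π (a i)) N' (fun i => ρ (b i))) ∧
      (∀ (N' : T.World) (ρ : T.Dom N ↪[L] T.Dom N'), ρ ∈ T.Emb N N' →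
        ∃ (M' : S.World) (π : S.Dom M ↪[L] S.Dom M'), π ∈ S.Emb M M' ∧
          R n M' (fun i => π (a i)) N' (fun i => ρ (b i)))

/-- Two pointed systems are bisimilar if some bisimulation relates them. -/
def Bisimilar.{u, v, w, x, w', x'} {L : FirstOrder.Language.{u, v}}
    (S : PotSys.{u, v, w, x} L) (T : PotSys.{u, v, w', x'} L)
    {n : ℕ} (M : S.World) (a : Fin n → S.Dom M) (N : T.World) (b : Fin n → T.Dom N) : Prop :=
  ∃ R : BisimRel S T, IsBisimulation S T R ∧ R n M a N b

/-- A relation is bitotal if every pair on the left is related to some pair on the right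
and vice versa. -/
def Bitotal.{u, v, w, x, w', x'} {L : FirstOrder.Language.{u, v}}
    (S : PotSys.{u, v, w, x} L) (T : PotSys.{u, v, w', x'} L) (R : BisimRel S T) : Prop :=
  (∀ (n : ℕ) (M : S.World) (a : Fin n → S.Dom M), ∃ N b, R n M a N b) ∧
  (∀ (n : ℕ) (N : T.World) (b : Fin n → T.Dom N), ∃ M a, R n M a N b)

/-- Two potentialist systems are bitotally bisimilar if there is a bitotal bisimulation
between them. -/
def BitotallyBisimilar.{u, v, w, x, w', x'} {L : FirstOrder.Language.{u, v}}
    (S : PotSys.{u, v, w, x} L) (T : PotSys.{u, v, w', x'} L) : Prop :=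
  ∃ R : BisimRel S T, IsBisimulation S T R ∧ Bitotal S T R

/-- An iso-bisimulation between potentialist systems: a nonempty relation between worlds
together with a system of isomorphisms, such that embeddings on either side can be matched
by embeddings on the other side, commuting with the isomorphisms. -/
structure IsoBisim.{u, v, w, x, w', x'} {L : FirstOrder.Language.{u, v}}
    (S : PotSys.{u, v, w, x} L) (T : PotSys.{u, v, w', x'} L) where
  rel : S.World → T.World → Prop
  nonempty : ∃ M N, rel M N
  iso : ∀ {M : S.World} {N : T.World}, rel M N → (S.Dom M ≃[L] T.Dom N)
  forth : ∀ {M : S.World} {N : T.World} (h : rel M N) (M' : S.World)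
      (π : S.Dom M ↪[L] S.Dom M'), π ∈ S.Emb M M' →
      ∃ (N' : T.World) (ρ : T.Dom N ↪[L] T.Dom N') (_ : ρ ∈ T.Emb N N') (h' : rel M' N'),
        ∀ y : S.Dom M, iso h' (π y) = ρ (iso h y)
  back : ∀ {M : S.World} {N : T.World} (h : rel M N) (N' : T.World)
      (ρ : T.Dom N ↪[L] T.Dom N'), ρ ∈ T.Emb N N' →
      ∃ (M' : S.World) (π : S.Dom M ↪[L] S.Dom M') (_ : π ∈ S.Emb M M') (h' : rel M' N'),
        ∀ y : S.Dom M, iso h' (π y) = ρ (iso h y)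

/-- An iso-bisimulation is bitotal if every world on either side takes part in the relation. -/
def IsoBisim.Bitotal.{u, v, w, x, w', x'} {L : FirstOrder.Language.{u, v}}
    {S : PotSys.{u, v, w, x} L} {T : PotSys.{u, v, w', x'} L} (I : IsoBisim S T) : Prop :=
  (∀ M : S.World, ∃ N, I.rel M N) ∧ (∀ N : T.World, ∃ M, I.rel M N)


/-- Formulas of the infinitary modal language `L^◇_∞`, with free variables among `Fin n`:
built from atomic `L`-formulas by negation, conjunctions and disjunctions indexed by an
arbitrary type (so that each formula has only finitely many free variables), quantifiers,
and the modal operators `◇` and `□`. -/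
inductive MFormula.{t, u, v} (L : FirstOrder.Language.{u, v}) : ℕ → Type (max u v (t + 1))
  | equal {n : ℕ} (t₁ t₂ : L.Term (Fin n)) : MFormula L n
  | rel {n l : ℕ} (R : L.Relations l) (ts : Fin l → L.Term (Fin n)) : MFormula L n
  | not {n : ℕ} (φ : MFormula L n) : MFormula L n
  | iAll {n : ℕ} {ι : Type t} (φ : ι → MFormula L n) : MFormula L n
  | iEx {n : ℕ} {ι : Type t} (φ : ι → MFormula L n) : MFormula L n
  | all {n : ℕ} (φ : MFormula L (n + 1)) : MFormula L n
  | ex {n : ℕ} (φ : MFormula L (n + 1)) : MFormula L n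
  | box {n : ℕ} (φ : MFormula L n) : MFormula L n
  | dia {n : ℕ} (φ : MFormula L n) : MFormula L n

/-- Satisfaction of an `L^◇_∞`-formula at a world of a potentialist system, with a tuple of
parameters: `◇φ` holds iff `φ` holds at the image of the parameters under some embedding of
the system, and `□φ` holds iff `φ` holds under every such embedding. -/
def Sat.{t, u, v, w, x} {L : FirstOrder.Language.{u, v}} (S : PotSys.{u, v, w, x} L) :
    {n : ℕ} → (W : S.World) → (Fin n → S.Dom W) → MFormula.{t, u, v} L n → Prop
  | _, _, a, .equal t₁ t₂ => t₁.realize a = t₂.realize a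
  | _, _, a, .rel R ts => Structure.RelMap R fun i => (ts i).realize a
  | _, W, a, .not φ => ¬ Sat S W a φ
  | _, W, a, .iAll φ => ∀ i, Sat S W a (φ i)
  | _, W, a, .iEx φ => ∃ i, Sat S W a (φ i)
  | _, W, a, .all φ => ∀ c, Sat S W (Fin.snoc a c) φ
  | _, W, a, .ex φ => ∃ c, Sat S W (Fin.snoc a c) φ
  | _, W, a, .box φ => ∀ (W' : S.World) (π : S.Dom W ↪[L] S.Dom W'),
      π ∈ S.Emb W W' → Sat S W' (fun i => π (a i)) φ
  | _, W, a, .dia φ => ∃ (W' : S.World) (π : S.Dom W ↪[L] S.Dom W'),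
      π ∈ S.Emb W W' ∧ Sat S W' (fun i => π (a i)) φ

/-- The modal-quantifier rank of an `L^◇_∞`-formula: atomic formulas have rank `0`;
negation preserves rank; conjunctions and disjunctions take the supremum of the ranks;
quantifiers and modal operators add `1`. -/
noncomputable def mqrank.{t, u, v} {L : FirstOrder.Language.{u, v}} :
    {n : ℕ} → MFormula.{t, u, v} L n → Ordinal.{t}
  | _, .equal _ _ => 0
  | _, .rel _ _ => 0
  | _, .not φ => mqrank φ
  | _, .iAll φ => ⨆ i, mqrank (φ i)
  | _, .iEx φ => ⨆ i, mqrank (φ i)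
  | _, .all φ => mqrank φ + 1
  | _, .ex φ => mqrank φ + 1
  | _, .box φ => mqrank φ + 1
  | _, .dia φ => mqrank φ + 1


theorem AtomicEquiv.realize_eq_iff.{u, v, y, z} {L : FirstOrder.Language.{u, v}}
    {M : Type y} {N : Type z} [L.Structure M] [L.Structure N] {n : ℕ}
    {a : Fin n → M} {b : Fin n → N} (h : AtomicEquiv L a b) (t₁ t₂ : L.Term (Fin n)) :
    t₁.realize a = t₂.realize a ↔ t₁.realize b = t₂.realize b := by
  simpa only [Formula.realize_equal] using h (t₁.equal t₂) (.equal _ _)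

theorem AtomicEquiv.relMap_iff.{u, v, y, z} {L : FirstOrder.Language.{u, v}}
    {M : Type y} {N : Type z} [L.Structure M] [L.Structure N] {n l : ℕ}
    {a : Fin n → M} {b : Fin n → N} (h : AtomicEquiv L a b)
    (R : L.Relations l) (ts : Fin l → L.Term (Fin n)) :
    (Structure.RelMap R fun i => (ts i).realize a) ↔
      Structure.RelMap R fun i => (ts i).realize b := by
  simpa only [Formula.realize_rel] using h (R.formula ts) (.rel _ _)

theorem IsBisimulation.sat_iff.{t, u, v, w, x, w', x'} {L : FirstOrder.Language.{u, v}}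
    {S : PotSys.{u, v, w, x} L} {T : PotSys.{u, v, w', x'} L} {R : BisimRel S T}
    (hR : IsBisimulation S T R) {n : ℕ} (φ : MFormula.{t, u, v} L n)
    {M : S.World} {a : Fin n → S.Dom M} {N : T.World} {b : Fin n → T.Dom N}
    (h : R n M a N b) : Sat S M a φ ↔ Sat T N b φ := by
  induction φ generalizing M N with
  | equal t₁ t₂ => exact (hR.2 _ _ _ _ _ h).1.realize_eq_iff t₁ t₂
  | rel r ts => exact (hR.2 _ _ _ _ _ h).1.relMap_iff r ts
  | not φ ih => exact not_congr (ih h)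
  | iAll φ ih => exact forall_congr' fun i => ih i h
  | iEx φ ih => exact exists_congr fun i => ih i h
  | all φ ih =>
    obtain ⟨-, forth, back, -, -⟩ := hR.2 _ _ _ _ _ h
    constructor
    · intro hφ d
      obtain ⟨c, hcd⟩ := back d
      exact (ih hcd).1 (hφ c)
    · intro hφ c
      obtain ⟨d, hcd⟩ := forth c
      exact (ih hcd).2 (hφ d)
  | ex φ ih =>
    obtain ⟨-, forth, back, -, -⟩ := hR.2 _ _ _ _ _ h
    constructor
    · rintro ⟨c, hc⟩
      obtain ⟨d, hcd⟩ := forth c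
      exact ⟨d, (ih hcd).1 hc⟩
    · rintro ⟨d, hd⟩
      obtain ⟨c, hcd⟩ := back d
      exact ⟨c, (ih hcd).2 hd⟩
  | box φ ih =>
    obtain ⟨-, -, -, forth, back⟩ := hR.2 _ _ _ _ _ h
    constructor
    · intro hφ N' ρ hρ
      obtain ⟨M', π, hπ, h'⟩ := back N' ρ hρ
      exact (ih h').1 (hφ M' π hπ)
    · intro hφ M' π hπ
      obtain ⟨N', ρ, hρ, h'⟩ := forth M' π hπ
      exact (ih h').2 (hφ N' ρ hρ)
  | dia φ ih =>
    obtain ⟨-, -, -, forth, back⟩ := hR.2 _ _ _ _ _ h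
    constructor
    · rintro ⟨M', π, hπ, hφ⟩
      obtain ⟨N', ρ, hρ, h'⟩ := forth M' π hπ
      exact ⟨N', ρ, hρ, (ih h').1 hφ⟩
    · rintro ⟨N', ρ, hρ, hφ⟩
      obtain ⟨M', π, hπ, h'⟩ := back N' ρ hρ
      exact ⟨M', π, hπ, (ih h').2 hφ⟩

/-- **Fundamental Theorem of Bisimulations** (Statement 0): if two pointed systems are
bisimilar then they are `L^◇_∞`-elementarily equivalent. -/
theorem fundamental_theorem_of_bisimulations.{t, u, v, w, x, w', x'}
    {L : FirstOrder.Language.{u, v}}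
    (S : PotSys.{u, v, w, x} L) (T : PotSys.{u, v, w', x'} L)
    {n : ℕ} (M : S.World) (a : Fin n → S.Dom M) (N : T.World) (b : Fin n → T.Dom N)
    (h : Bisimilar S T M a N b) (φ : MFormula.{t, u, v} L n) :
    Sat S M a φ ↔ Sat T N b φ := by
  obtain ⟨R, hR, h⟩ := h
  exact hR.sat_iff φ h

end Potentialist
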